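/- In the transfinite construction over a full model N: for every ordinal α, if L t ⇝_α ⊤ then there exist a term t' and a type τ ∈ T⁺ such that t ↠_{≤α} t' and t' ∼ τ (where ∼ is the stable typing relation at the closure ordinal). -/

import Mathlib

/-! Infrastructure: the transfinite model construction over a full model of
classical higher-order logic, following Czajka, "A semantic approach to illative
combinatory logic", Section 4. -/

namespace ILM

/-- Type-free λ-terms over a set `C` of primitive constants (de Bruijn representation). -/
inductive Tm (C : Type) : Type
  | var : Nat → Tm C
  | const : C → Tm C
  | app : Tm C → Tm C → Tm C
  | lam : Tm C → Tm C

namespace Tm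

variable {C : Type}

/-- Renaming of free de Bruijn variables. -/
def rename (f : Nat → Nat) : Tm C → Tm C
  | .var n => .var (f n)
  | .const c => .const c
  | .app a b => .app (a.rename f) (b.rename f)
  | .lam a => .lam (a.rename fun n => match n with | 0 => 0 | m + 1 => f m + 1)

/-- Shift all free variables up by one. -/
def lift (t : Tm C) : Tm C := t.rename (· + 1)

/-- Simultaneous substitution. -/
def bind (σ : Nat → Tm C) : Tm C → Tm C
  | .var n => σ n
  | .const c => .const c
  | .app a b => .app (a.bind σ) (b.bind σ)
  | .lam a => .lam (a.bind fun n => match n with | 0 => .var 0 | m + 1 => (σ m).lift)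

/-- Substitution of `s` for the variable `0` (β-contraction of `(λ.t) s`). -/
def subst0 (t s : Tm C) : Tm C := t.bind fun n => match n with | 0 => s | m + 1 => .var m

end Tm

/-- Extended types `T⁺`: the constructors generate all expressions
`o | B | arr | ω | ε`; the grammar `T⁺ ::= T₁ | ω | ε`, `T₁ ::= T | T₁→T₁ | ω→T₁`
is captured by the predicate `IsT1` below. -/
inductive ETy (B : Type) : Type
  | o : ETy B
  | base : B → ETy B
  | arr : ETy B → ETy B → ETy B
  | omega : ETy B
  | eps : ETy B
deriving DecidableEq

/-- Membership in `T₁` (so `T⁺ = T₁ ∪ {ω, ε}`). -/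
inductive IsT1 {B : Type} : ETy B → Prop
  | o : IsT1 .o
  | base (b : B) : IsT1 (.base b)
  | arr {τ1 τ2 : ETy B} : IsT1 τ1 → IsT1 τ2 → IsT1 (.arr τ1 τ2)
  | omegaArr {τ2 : ETy B} : IsT1 τ2 → IsT1 (.arr .omega τ2)

/-- Membership in `T⁺`. -/
def IsTp {B : Type} (τ : ETy B) : Prop := IsT1 τ ∨ τ = .omega ∨ τ = .eps

/-- The normalized arrow `τ₁ → τ₂`, implementing the notational conventions
`τ→ε = ε` (for `τ ≠ ε`), `ε→τ = ω` and `τ→ω = ω`. -/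
def arrN {B : Type} : ETy B → ETy B → ETy B
  | _, .omega => .omega
  | .eps, _ => .omega
  | _, .eps => .eps
  | τ1, τ2 => .arr τ1 τ2

/-- The rank of a type. -/
def rank {B : Type} : ETy B → Nat
  | .arr τ1 τ2 => max (rank τ1 + 1) (rank τ2)
  | _ => 1

/-- A canonical system over domains `D` for the base types: the primitive
constants `Σ⁺ = {Ξ, L} ∪ {A_τ : τ ∈ B} ∪ ⋃_τ Σ_τ`, the sets `T_τ` of canonical
terms of each type, the distinguished canonical constants `⊤, ⊥` of type `o`,
and the function `F` associating to each canonical term of a function type its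
set-theoretic function, as constructed in the paper from a full model
`N = ⟨{D_τ}, I⟩` of classical higher-order logic.  The fields axiomatize the
construction: the sets of canonical terms of distinct types are disjoint sets of
closed normal terms (`T_ω` is the set of all terms, `T_ε = ∅`), for `τ₁ ≠ ω`
the canonical terms of type `τ₁→τ₂` are constants corresponding bijectively
(via `F`) to *all* set-theoretic functions from `T_{τ₁}` to `T_{τ₂}` (this is
where fullness of `N` enters), the canonical terms of type `ω→τ₂` are the terms
`λx.ρ` with `ρ ∈ T_{τ₂}` (with `F` giving constant functions), the canonical
terms of base type `b` correspond bijectively to the domain `D b`, and those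
of type `o` are exactly `⊤` and `⊥`. -/
structure CanSys (B : Type) (D : B → Type) where
  /-- the primitive constants `Σ⁺` -/
  C : Type
  cXi : C
  cL : C
  cA : B → C
  /-- the sets `T_τ` of canonical terms -/
  TT : ETy B → Set (Tm C)
  /-- the canonical constant `⊤ ∈ Σ_o` -/
  top : Tm C
  /-- the canonical constant `⊥ ∈ Σ_o` -/
  bot : Tm C
  /-- `F τ₁ τ₂ ρ t` : the value at `t ∈ T_{τ₁}` of the function associated with
  the canonical term `ρ ∈ T_{τ₁→τ₂}` -/
  F : ETy B → ETy B → Tm C → Tm C → Tm C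
  hXiL : cXi ≠ cL
  hXiA : ∀ b, cXi ≠ cA b
  hLA : ∀ b, cL ≠ cA b
  hAinj : Function.Injective cA
  TT_omega : TT .omega = Set.univ
  TT_eps : TT .eps = ∅
  TT_invalid : ∀ τ : ETy B, ¬ IsT1 τ → τ ≠ .omega → TT τ = ∅
  TT_o : TT .o = {top, bot}
  top_ne_bot : top ≠ bot
  TT_const : ∀ τ : ETy B, IsT1 τ → (∀ τ2, τ ≠ .arr .omega τ2) →
    ∀ t ∈ TT τ, ∃ c : C, t = .const c
  TT_base_equiv : ∀ b : B, Nonempty (D b ≃ TT (.base b))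
  TT_omega_arr : ∀ τ2 : ETy B, IsT1 τ2 → TT (.arr .omega τ2) = Tm.lam '' TT τ2
  F_omega : ∀ τ2 : ETy B, ∀ ρ ∈ TT τ2, ∀ t : Tm C, F .omega τ2 (.lam ρ) t = ρ
  F_mapsto : ∀ τ1 τ2 : ETy B, IsT1 (.arr τ1 τ2) →
    ∀ ρ ∈ TT (.arr τ1 τ2), ∀ t ∈ TT τ1, F τ1 τ2 ρ t ∈ TT τ2
  F_full : ∀ τ1 τ2 : ETy B, IsT1 (.arr τ1 τ2) → τ1 ≠ .omega →
    ∀ g : Tm C → Tm C, (∀ t ∈ TT τ1, g t ∈ TT τ2) →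
      ∃ ρ ∈ TT (.arr τ1 τ2), ∀ t ∈ TT τ1, F τ1 τ2 ρ t = g t
  F_inj : ∀ τ1 τ2 : ETy B, IsT1 (.arr τ1 τ2) → τ1 ≠ .omega →
    ∀ ρ ∈ TT (.arr τ1 τ2), ∀ ρ' ∈ TT (.arr τ1 τ2),
      (∀ t ∈ TT τ1, F τ1 τ2 ρ t = F τ1 τ2 ρ' t) → ρ = ρ'
  TT_disj : ∀ τ τ' : ETy B, τ ≠ τ' → τ ≠ .omega → τ' ≠ .omega →
    Disjoint (TT τ) (TT τ')
  prim_notin : ∀ τ : ETy B, τ ≠ .omega →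
    Tm.const cXi ∉ TT τ ∧ Tm.const cL ∉ TT τ ∧ ∀ b, Tm.const (cA b) ∉ TT τ
  cover : ∀ c : C, c = cXi ∨ c = cL ∨ (∃ b, c = cA b) ∨
    ∃ τ : ETy B, τ ≠ .omega ∧ Tm.const c ∈ TT τ

namespace CanSys

variable {B : Type} {D : B → Type} (S : CanSys B D)

/-- The term `Ξ`. -/
def XiT : Tm S.C := .const S.cXi

/-- The term `L`. -/
def LT : Tm S.C := .const S.cL

/-- The term `A_b`. -/
def AT (b : B) : Tm S.C := .const (S.cA b)

/-- `K t = λx.t` with `x ∉ FV(t)`. -/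
def Kt (t : Tm S.C) : Tm S.C := .lam t.lift

/-- `H t = L (K t)`. -/
def Ht (t : Tm S.C) : Tm S.C := .app S.LT (S.Kt t)

/-- The term `H = λx. L (K x)`. -/
def Hterm : Tm S.C := .lam (.app S.LT (.lam (.var 1)))

/-- `F t₁ t₂`, written out according to the notational convention:
`λf. Ξ t₁ (λx. t₂ (f x))` if `t₂` is not a λ-abstraction, and
`λf. Ξ t₁ (λx. q₂[z/(f x)])` if `t₂ = λz. q₂`. -/
def Ft (t1 t2 : Tm S.C) : Tm S.C :=
  .lam (.app (.app S.XiT t1.lift)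
    (match t2 with
     | .lam b => .lam (b.bind fun n => match n with
         | 0 => .app (.var 1) (.var 0)
         | m + 1 => .var (m + 2))
     | t2 => .lam (.app t2.lift.lift (.app (.var 1) (.var 0)))))

end CanSys


mutual
  /-- One-step reduction `→_{≤α}` of the reduction system `R_α`: the context
  closure of β- and η-reduction together with the rules `c t → F(c)(ρ₁)` for
  canonical constants `c ∈ Σ_{τ₁→τ₂}` (`τ₁ ≠ ω`) and `t ≻_{<α} ρ₁`. -/
  inductive Step {B : Type} {D : B → Type} (S : CanSys B D) :
      Ordinal.{0} → Tm S.C → Tm S.C → Prop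
    | beta (α : Ordinal.{0}) (t s : Tm S.C) : Step S α (.app (.lam t) s) (t.subst0 s)
    | eta (α : Ordinal.{0}) (t : Tm S.C) : Step S α (.lam (.app t.lift (.var 0))) t
    | crule {α γ : Ordinal.{0}} (hγ : γ < α) {τ1 τ2 : ETy B} (h1 : τ1 ≠ .omega)
        {c : Tm S.C} (hc : c ∈ S.TT (.arr τ1 τ2)) {ρ1 : Tm S.C} (hρ1 : ρ1 ∈ S.TT τ1)
        {t : Tm S.C} (hs : Succ S γ t ρ1) :
        Step S α (.app c t) (S.F τ1 τ2 c ρ1)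
    | appL {α : Ordinal.{0}} {t t' : Tm S.C} (s : Tm S.C) :
        Step S α t t' → Step S α (.app t s) (.app t' s)
    | appR (t : Tm S.C) {α : Ordinal.{0}} {s s' : Tm S.C} :
        Step S α s s' → Step S α (.app t s) (.app t s')
    | lam {α : Ordinal.{0}} {t t' : Tm S.C} :
        Step S α t t' → Step S α (.lam t) (.lam t')

  /-- Many-step reduction `↠_{≤α}` (the reflexive-transitive closure of `→_{≤α}`). -/
  inductive Steps {B : Type} {D : B → Type} (S : CanSys B D) :
      Ordinal.{0} → Tm S.C → Tm S.C → Prop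
    | refl (α : Ordinal.{0}) (t : Tm S.C) : Steps S α t t
    | tail {α : Ordinal.{0}} {t u v : Tm S.C} :
        Steps S α t u → Step S α u v → Steps S α t v

  /-- `t ⇝_α ρ` : `t ↠_{≤α} t' ≻_α ρ` for some `t'`. -/
  inductive Lead {B : Type} {D : B → Type} (S : CanSys B D) :
      Ordinal.{0} → Tm S.C → Tm S.C → Prop
    | mk {α : Ordinal.{0}} {t t' ρ : Tm S.C} :
        Steps S α t t' → Succ S α t' ρ → Lead S α t ρ

  /-- `t ⇝_{<α} ρ` : `t ⇝_γ ρ` for some `γ < α`. -/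
  inductive LeadLt {B : Type} {D : B → Type} (S : CanSys B D) :
      Ordinal.{0} → Tm S.C → Tm S.C → Prop
    | mk {α γ : Ordinal.{0}} {t ρ : Tm S.C} :
        γ < α → Lead S γ t ρ → LeadLt S α t ρ

  /-- The typing relation `t ∼_α τ` (Definition 4.4), by the rules
  (A), (H), (Kω), (Kε), (F) and (Fω). -/
  inductive Sim {B : Type} {D : B → Type} (S : CanSys B D) :
      Ordinal.{0} → Tm S.C → ETy B → Prop
    | ofA (α : Ordinal.{0}) (b : B) : Sim S α (S.AT b) (.base b)
    | ofH (α : Ordinal.{0}) : Sim S α S.Hterm .o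
    | ofKom {α : Ordinal.{0}} {t : Tm S.C} :
        LeadLt S α t S.top → Sim S α (S.Kt t) .omega
    | ofKeps {α : Ordinal.{0}} {t : Tm S.C} :
        LeadLt S α t S.bot → Sim S α (S.Kt t) .eps
    | ofF {α γ1 γ2 : Ordinal.{0}} (h1 : γ1 < α) (h2 : γ2 < α)
        {t1 t2 : Tm S.C} {τ1 τ2 : ETy B} :
        Sim S γ1 t1 τ1 → Sim S γ2 t2 τ2 → Sim S α (S.Ft t1 t2) (arrN τ1 τ2)
    | ofFom {α γ : Ordinal.{0}} (hγ : γ < α) {t1 t2 : Tm S.C} :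
        Sim S γ t1 .eps → Sim S α (S.Ft t1 t2) .omega

  /-- The relation `t ≻_α ρ` between terms and canonical terms (Definition 4.5). -/
  inductive Succ {B : Type} {D : B → Type} (S : CanSys B D) :
      Ordinal.{0} → Tm S.C → Tm S.C → Prop
    /- `ρ ≻_α ρ` for canonical `ρ` -/
    | refl {τ : ETy B} (hτ : τ ≠ .omega) {ρ : Tm S.C} (hρ : ρ ∈ S.TT τ)
        (α : Ordinal.{0}) : Succ S α ρ ρ
    /- `t ≻_α ρ` when `ρ` has canonical type `τ₁→τ₂` (possibly `τ₁ = ω`) and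
       `t t₁ ⇝_{<α} F(ρ)(t₁)` for all `t₁ ∈ T_{τ₁}` -/
    | fn {τ1 τ2 : ETy B} {ρ : Tm S.C} (hρ : ρ ∈ S.TT (.arr τ1 τ2))
        {α : Ordinal.{0}} {t : Tm S.C}
        (h : ∀ t1 ∈ S.TT τ1, LeadLt S α (.app t t1) (S.F τ1 τ2 ρ t1)) :
        Succ S α t ρ
    /- base postulates for `t ≻_α ⊤` -/
    | topLA (α : Ordinal.{0}) (b : B) : Succ S α (.app S.LT (S.AT b)) S.top
    | topLH (α : Ordinal.{0}) : Succ S α (.app S.LT S.Hterm) S.top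
    | topA {b : B} {c : Tm S.C} (hc : c ∈ S.TT (.base b)) (α : Ordinal.{0}) :
        Succ S α (.app (S.AT b) c) S.top
    | topH {c : Tm S.C} (hc : c = S.top ∨ c = S.bot) (α : Ordinal.{0}) :
        Succ S α (S.Ht c) S.top
    /- `(Ξ_i^⊤)` -/
    | xiTop {α : Ordinal.{0}} (hα : 0 < α) {t1 t2 : Tm S.C} {τ : ETy B}
        (h1 : Sim S α t1 τ) (h2 : ∀ t3 ∈ S.TT τ, LeadLt S α (.app t2 t3) S.top) :
        Succ S α (.app (.app S.XiT t1) t2) S.top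
    /- `(Ξ_H^⊤)` -/
    | xiHTop {α : Ordinal.{0}} (hα : 0 < α) {t1 t2 : Tm S.C} {τ : ETy B}
        (h1 : Sim S α t1 τ)
        (h2 : ∀ t3 ∈ S.TT τ, LeadLt S α (S.Ht (.app t2 t3)) S.top) :
        Succ S α (S.Ht (.app (.app S.XiT t1) t2)) S.top
    /- `(F_L^⊤)`, first case: `t₁ ∼_α ε` -/
    | flTopEps {α : Ordinal.{0}} (hα : 0 < α) {t1 t2 : Tm S.C}
        (h1 : Sim S α t1 .eps) :
        Succ S α (.app S.LT (S.Ft t1 t2)) S.top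
    /- `(F_L^⊤)`, second case: `t₁ ∼_α τ` for some `τ ≠ ε` and `L t₂ ⇝_{<α} ⊤` -/
    | flTop {α : Ordinal.{0}} (hα : 0 < α) {t1 t2 : Tm S.C} {τ : ETy B}
        (hτ : τ ≠ .eps) (h1 : Sim S α t1 τ) (h2 : LeadLt S α (.app S.LT t2) S.top) :
        Succ S α (.app S.LT (S.Ft t1 t2)) S.top
    /- `(H_i^⊤)` -/
    | hiTop {α : Ordinal.{0}} (hα : 0 < α) {t1 : Tm S.C} (h : LeadLt S α t1 S.top) :
        Succ S α (S.Ht t1) S.top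
    /- `(Ξ^⊥)` -/
    | xiBot {α : Ordinal.{0}} (hα : 0 < α) {t1 t2 : Tm S.C} {τ : ETy B}
        {γ : Ordinal.{0}} (hγ : γ < α)
        (hH : Succ S γ (S.Ht (.app (.app S.XiT t1) t2)) S.top)
        (h1 : Sim S α t1 τ) {t3 : Tm S.C} (h3 : t3 ∈ S.TT τ)
        (hb : LeadLt S α (.app t2 t3) S.bot) :
        Succ S α (.app (.app S.XiT t1) t2) S.bot
end


variable {B : Type} {D : B → Type}

/-- `t ≻ ρ` : the stable relation `≻_ζ` at the closure ordinal (by monotonicity,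
it equals the union of the `≻_α` over all ordinals `α`). -/
def SuccS (S : CanSys B D) (t ρ : Tm S.C) : Prop := ∃ α : Ordinal.{0}, Succ S α t ρ

/-- `t ∼ τ` : the stable typing relation. -/
def SimS (S : CanSys B D) (t : Tm S.C) (τ : ETy B) : Prop := ∃ α : Ordinal.{0}, Sim S α t τ

/-- One-step reduction of the stable reduction system `R`. -/
def StepR (S : CanSys B D) (t t' : Tm S.C) : Prop := ∃ α : Ordinal.{0}, Step S α t t'

/-- `t ↠_R t'` : many-step reduction in the stable reduction system `R`. -/
def StepsR (S : CanSys B D) : Tm S.C → Tm S.C → Prop := Relation.ReflTransGen (StepR S)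

/-- `t ⇝ ρ` : the stable relation `⇝_ζ`. -/
def LeadR (S : CanSys B D) (t ρ : Tm S.C) : Prop :=
  ∃ t', StepsR S t t' ∧ SuccS S t' ρ

/-- `t =_{≤α} t'` : convertibility in `R_α`. -/
def ConvLe (S : CanSys B D) (α : Ordinal.{0}) : Tm S.C → Tm S.C → Prop :=
  Relation.EqvGen (Step S α)

/-- `t =_R t'` : convertibility in the stable reduction system `R`. -/
def ConvR (S : CanSys B D) : Tm S.C → Tm S.C → Prop :=
  Relation.EqvGen (StepR S)

/-- Filling the boxes `□₁, …, □ₖ` of a `k`-ary context (a λ-term over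
`Σ⁺ ∪ {□₁, …, □ₖ}`) with terms, in such a way that the free variables of the
inserted terms do not become bound. -/
def fillk {C : Type} {k : Nat} (ts : Fin k → Tm C) : Tm (Fin k ⊕ C) → Tm C
  | .var n => .var n
  | .const (.inl i) => ts i
  | .const (.inr c) => .const c
  | .app a b => .app (fillk ts a) (fillk ts b)
  | .lam a => .lam (fillk (fun i => (ts i).lift) a)

/-- Filling a unary context. -/
def fill1 {C : Type} (Ctx : Tm (Fin 1 ⊕ C)) (t : Tm C) : Tm C :=
  fillk (fun _ => t) Ctx

/-- `t ≫^n t'` (at the stable level): there are a `k`-ary context `Cx`, terms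
`t₁, …, t_k` and canonical terms `ρ₁, …, ρ_k` of ranks `≤ n` with `tᵢ ≻ ρᵢ`,
`t = Cx[t₁,…,t_k]` and `t' = Cx[ρ₁,…,ρ_k]`. -/
def Gg (S : CanSys B D) (n : Nat) (t t' : Tm S.C) : Prop :=
  ∃ (k : Nat) (Cx : Tm (Fin k ⊕ S.C)) (ts ρs : Fin k → Tm S.C),
    (∀ i, SuccS S (ts i) (ρs i)) ∧
    (∀ i, ∃ τ : ETy B, τ ≠ .omega ∧ ρs i ∈ S.TT τ ∧ rank τ ≤ n) ∧
    t = fillk ts Cx ∧ t' = fillk ρs Cx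


namespace Tm

variable {C : Type}

/-- Extension of a renaming under a binder. -/
def upRen (f : Nat → Nat) : Nat → Nat
  | 0 => 0
  | m + 1 => f m + 1

/-- Extension of a substitution under a binder. -/
def upSub (σ : Nat → Tm C) : Nat → Tm C
  | 0 => .var 0
  | m + 1 => (σ m).lift

/-- The substitution replacing variable `0` by `s` and lowering the others. -/
def instSub (s : Tm C) : Nat → Tm C
  | 0 => s
  | m + 1 => .var m

theorem rename_lam (f : Nat → Nat) (a : Tm C) :
    (Tm.lam a).rename f = .lam (a.rename (upRen f)) := by
  simp only [rename]
  congr 2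

theorem bind_lam (σ : Nat → Tm C) (a : Tm C) :
    (Tm.lam a).bind σ = .lam (a.bind (upSub σ)) := by
  simp only [bind]
  congr 2

theorem subst0_eq (t s : Tm C) : t.subst0 s = t.bind (instSub s) := by
  unfold subst0
  congr 1

theorem rename_rename (t : Tm C) (f g : Nat → Nat) :
    (t.rename f).rename g = t.rename (g ∘ f) := by
  induction t generalizing f g with
  | var n => rfl
  | const c => rfl
  | app a b iha ihb => simp [rename, iha, ihb]
  | lam a ih =>
    rw [rename_lam, rename_lam, rename_lam, ih]
    congr 2
    funext n
    cases n <;> rfl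

theorem bind_rename_left (t : Tm C) (f : Nat → Nat) (σ : Nat → Tm C) :
    (t.rename f).bind σ = t.bind (σ ∘ f) := by
  induction t generalizing f σ with
  | var n => rfl
  | const c => rfl
  | app a b iha ihb => simp [rename, bind, iha, ihb]
  | lam a ih =>
    rw [rename_lam, bind_lam, bind_lam, ih]
    congr 2
    funext n
    cases n <;> rfl

theorem rename_bind (t : Tm C) (σ : Nat → Tm C) (f : Nat → Nat) :
    (t.bind σ).rename f = t.bind (fun n => (σ n).rename f) := by
  induction t generalizing f σ with
  | var n => rfl
  | const c => rfl
  | app a b iha ihb => simp [rename, bind, iha, ihb]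
  | lam a ih =>
    rw [bind_lam, bind_lam, rename_lam, ih]
    congr 2
    funext n
    cases n with
    | zero => rfl
    | succ m =>
      simp only [upSub, lift, rename_rename]
      rfl

theorem bind_bind (t : Tm C) (σ θ : Nat → Tm C) :
    (t.bind σ).bind θ = t.bind (fun n => (σ n).bind θ) := by
  induction t generalizing σ θ with
  | var n => rfl
  | const c => rfl
  | app a b iha ihb => simp [bind, iha, ihb]
  | lam a ih =>
    rw [bind_lam, bind_lam, bind_lam, ih]
    congr 2
    funext n
    cases n with
    | zero => rfl
    | succ m =>
      simp only [upSub, lift, bind_rename_left, rename_bind]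
      rfl

theorem bind_var (t : Tm C) : t.bind Tm.var = t := by
  induction t with
  | var n => rfl
  | const c => rfl
  | app a b iha ihb => simp [bind, iha, ihb]
  | lam a ih =>
    rw [bind_lam]
    have h : upSub (Tm.var : Nat → Tm C) = Tm.var := by
      funext n
      cases n <;> rfl
    rw [h, ih]

theorem rename_eq_bind (t : Tm C) (f : Nat → Nat) : t.rename f = t.bind (fun n => .var (f n)) := by
  conv_lhs => rw [← bind_var t, rename_bind]
  rfl

theorem lift_eq_bind (t : Tm C) : t.lift = t.bind (fun n => .var (n + 1)) :=
  rename_eq_bind t _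

theorem lift_bind_upSub (t : Tm C) (σ : Nat → Tm C) : t.lift.bind (upSub σ) = (t.bind σ).lift := by
  simp only [lift, bind_rename_left, rename_bind]
  rfl

theorem lift_bind_instSub (t s : Tm C) : t.lift.bind (instSub s) = t := by
  rw [lift, bind_rename_left]
  exact bind_var t

theorem lift_injective : Function.Injective (lift : Tm C → Tm C) := fun a b h => by
  rw [← lift_bind_instSub a a, h, lift_bind_instSub]

theorem subst0_bind (t s : Tm C) (σ : Nat → Tm C) :
    (t.subst0 s).bind σ = (t.bind (upSub σ)).subst0 (s.bind σ) := by
  simp only [subst0_eq, bind_bind]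
  congr 1
  funext n
  cases n with
  | zero => rfl
  | succ m => simp only [upSub, lift_bind_instSub]; rfl

/-- The variable with index `n` occurs free. -/
def FreeIn : Nat → Tm C → Prop
  | n, .var m => m = n
  | _, .const _ => False
  | n, .app a b => FreeIn n a ∨ FreeIn n b
  | n, .lam a => FreeIn (n + 1) a

theorem bind_congr {t : Tm C} {σ θ : Nat → Tm C} (h : ∀ n, FreeIn n t → σ n = θ n) :
    t.bind σ = t.bind θ := by
  induction t generalizing σ θ with
  | var n => exact h n rfl
  | const c => rfl
  | app a b iha ihb =>
    simp only [bind]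
    rw [iha fun n hn => h n (.inl hn), ihb fun n hn => h n (.inr hn)]
  | lam a ih =>
    rw [bind_lam, bind_lam, ih]
    intro n hn
    cases n with
    | zero => rfl
    | succ m => simp only [upSub]; rw [h m hn]

theorem freeIn_rename {t : Tm C} {f : Nat → Nat} {n : Nat} :
    FreeIn n (t.rename f) ↔ ∃ m, FreeIn m t ∧ f m = n := by
  induction t generalizing f n with
  | var k => simp [rename, FreeIn]
  | const c => simp [rename, FreeIn]
  | app a b iha ihb => simp only [rename, FreeIn, iha, ihb, or_and_right, exists_or]
  | lam a ih =>
    simp only [rename_lam, FreeIn, ih]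
    constructor
    · rintro ⟨_ | m, hm, hf⟩
      · simp [upRen] at hf
      · exact ⟨m, hm, by simpa [upRen] using hf⟩
    · rintro ⟨m, hm, hf⟩
      exact ⟨m + 1, hm, by simp [upRen, hf]⟩

theorem freeIn_lift {t : Tm C} {n : Nat} : FreeIn (n + 1) t.lift ↔ FreeIn n t := by
  simp [lift, freeIn_rename]

theorem not_freeIn_lift (t : Tm C) : ¬ FreeIn 0 t.lift := by
  simp [lift, freeIn_rename]

theorem freeIn_bind {t : Tm C} {σ : Nat → Tm C} {n : Nat} :
    FreeIn n (t.bind σ) ↔ ∃ m, FreeIn m t ∧ FreeIn n (σ m) := by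
  induction t generalizing σ n with
  | var k => simp [bind, FreeIn]
  | const c => simp [bind, FreeIn]
  | app a b iha ihb => simp only [bind, FreeIn, iha, ihb, or_and_right, exists_or]
  | lam a ih =>
    simp only [bind_lam, FreeIn, ih]
    constructor
    · rintro ⟨_ | m, hm, hf⟩
      · simp [upSub, FreeIn] at hf
      · exact ⟨m, hm, freeIn_lift.1 hf⟩
    · rintro ⟨m, hm, hf⟩
      exact ⟨m + 1, hm, freeIn_lift.2 hf⟩

theorem exists_freeIn_bound (t : Tm C) : ∃ N, ∀ n, FreeIn n t → n < N := by
  induction t with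
  | var k => exact ⟨k + 1, fun n hn => by simp only [FreeIn] at hn; omega⟩
  | const c => exact ⟨0, fun n hn => hn.elim⟩
  | app a b iha ihb =>
    obtain ⟨M, hM⟩ := iha
    obtain ⟨N, hN⟩ := ihb
    exact ⟨max M N, fun n hn => hn.elim (fun h => lt_max_of_lt_left (hM n h))
      (fun h => lt_max_of_lt_right (hN n h))⟩
  | lam a ih =>
    obtain ⟨N, hN⟩ := ih
    exact ⟨N, fun n hn => (Nat.lt_succ_self n).trans (hN (n + 1) hn)⟩

theorem exists_lift_of_not_freeIn {t : Tm C} (h : ¬ FreeIn 0 t) : ∃ u : Tm C, t = u.lift := by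
  refine ⟨t.bind (instSub t), ?_⟩
  rw [lift, rename_bind]
  conv_lhs => rw [← bind_var t]
  refine bind_congr fun n hn => ?_
  cases n with
  | zero => exact (h hn).elim
  | succ m => rfl

end Tm

theorem IsT1.ne_omega {τ : ETy B} (h : IsT1 τ) : τ ≠ .omega := by
  rintro rfl
  cases h

theorem IsT1.cod {τ1 τ2 : ETy B} (h : IsT1 (.arr τ1 τ2)) : IsT1 τ2 := by
  cases h <;> assumption

theorem isTp_arrN {τ1 τ2 : ETy B} (h1 : IsTp τ1) (h2 : IsTp τ2) : IsTp (arrN τ1 τ2) := by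
  rcases h2 with h2 | rfl | rfl
  · rcases h1 with h1 | rfl | rfl
    · have h : arrN τ1 τ2 = .arr τ1 τ2 := by cases h1 <;> cases h2 <;> rfl
      rw [h]
      exact .inl (.arr h1 h2)
    · have h : arrN .omega τ2 = .arr .omega τ2 := by cases h2 <;> rfl
      rw [h]
      exact .inl (.omegaArr h2)
    · have h : arrN .eps τ2 = .omega := by cases h2 <;> rfl
      exact .inr (.inl h)
  · have h : arrN τ1 .omega = .omega := by cases τ1 <;> rfl
    exact .inr (.inl h)
  · cases τ1 with
    | eps => exact .inr (.inl rfl)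
    | _ => exact .inr (.inr rfl)

namespace CanSys

variable (S : CanSys B D)

theorem isT1_of_mem {τ : ETy B} (hτ : τ ≠ .omega) {ρ : Tm S.C} (h : ρ ∈ S.TT τ) : IsT1 τ := by
  by_contra hn
  rw [S.TT_invalid τ hn hτ] at h
  exact h

theorem top_mem : S.top ∈ S.TT .o := by simp [S.TT_o]

theorem bot_mem : S.bot ∈ S.TT .o := by simp [S.TT_o]

theorem const_or_lam {τ : ETy B} (h1 : IsT1 τ) {ρ : Tm S.C} (h : ρ ∈ S.TT τ) :
    (∃ c, ρ = .const c) ∨ ∃ τ2 ρ', IsT1 τ2 ∧ τ = .arr .omega τ2 ∧ ρ' ∈ S.TT τ2 ∧ ρ = .lam ρ' := by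
  by_cases ha : ∃ τ2, τ = .arr .omega τ2
  · obtain ⟨τ2, rfl⟩ := ha
    have h2 := h1.cod
    rw [S.TT_omega_arr τ2 h2] at h
    obtain ⟨ρ', hρ', rfl⟩ := h
    exact .inr ⟨τ2, ρ', h2, rfl, hρ', rfl⟩
  · exact .inl (S.TT_const τ h1 (by simpa using ha) ρ h)

theorem not_freeIn {τ : ETy B} (hτ : τ ≠ .omega) {ρ : Tm S.C} (h : ρ ∈ S.TT τ) (n : Nat) :
    ¬ Tm.FreeIn n ρ := by
  induction τ generalizing ρ n with
  | arr τ1 τ2 _ ih =>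
    rcases S.const_or_lam (S.isT1_of_mem hτ h) h with ⟨c, rfl⟩ | ⟨τ2', ρ', h2, he, hρ', rfl⟩
    · exact id
    · cases he
      exact ih h2.ne_omega hρ' (n + 1)
  | _ =>
    rcases S.const_or_lam (S.isT1_of_mem hτ h) h with ⟨c, rfl⟩ | ⟨τ2', ρ', h2, he, hρ', rfl⟩
    · exact id
    · cases he

theorem bind_eq_self {τ : ETy B} (hτ : τ ≠ .omega) {ρ : Tm S.C} (h : ρ ∈ S.TT τ)
    (σ : Nat → Tm S.C) : ρ.bind σ = ρ := by
  conv_rhs => rw [← Tm.bind_var ρ]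
  exact Tm.bind_congr fun n hn => (S.not_freeIn hτ h n hn).elim

theorem bind_mem {τ : ETy B} {ρ : Tm S.C} (h : ρ ∈ S.TT τ) (σ : Nat → Tm S.C) :
    ρ.bind σ ∈ S.TT τ := by
  by_cases hτ : τ = .omega
  · simp [hτ, S.TT_omega]
  · rwa [S.bind_eq_self hτ h]

theorem app_notMem {τ : ETy B} (hτ : τ ≠ .omega) {a b : Tm S.C} : Tm.app a b ∉ S.TT τ := by
  intro h
  rcases S.const_or_lam (S.isT1_of_mem hτ h) h with ⟨c, hc⟩ | ⟨τ2', ρ', h2, he, hρ', hc⟩ <;> cases hc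

theorem F_mem {τ1 τ2 : ETy B} {c t : Tm S.C} (hc : c ∈ S.TT (.arr τ1 τ2)) (ht : t ∈ S.TT τ1) :
    τ2 ≠ .omega ∧ S.F τ1 τ2 c t ∈ S.TT τ2 :=
  have h := S.isT1_of_mem (by simp) hc
  ⟨h.cod.ne_omega, S.F_mapsto τ1 τ2 h c hc t ht⟩

theorem LT_notMem (τ : ETy B) (hτ : τ ≠ .omega) : S.LT ∉ S.TT τ := (S.prim_notin τ hτ).2.1

theorem top_notMem_arr (τ1 τ2 : ETy B) : S.top ∉ S.TT (.arr τ1 τ2) := fun h =>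
  Set.disjoint_left.1 (S.TT_disj .o (.arr τ1 τ2) (by simp) (by simp) (by simp)) S.top_mem h

theorem Kt_bind (t : Tm S.C) (σ : Nat → Tm S.C) : (S.Kt t).bind σ = S.Kt (t.bind σ) := by
  simp only [Kt, Tm.bind_lam, Tm.lift_bind_upSub]

theorem Ht_bind (t : Tm S.C) (σ : Nat → Tm S.C) : (S.Ht t).bind σ = S.Ht (t.bind σ) := by
  show Tm.app S.LT ((S.Kt t).bind σ) = _
  rw [Kt_bind]
  rfl

theorem Kt_injective : Function.Injective S.Kt := fun a b h => by
  simp only [Kt, Tm.lam.injEq] at h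
  exact Tm.lift_injective h

/-- The substitution `z ↦ f x` in the body of `F t₁ (λz.q)`. -/
def fSub : Nat → Tm S.C
  | 0 => .app (.var 1) (.var 0)
  | m + 1 => .var (m + 2)

/-- The second argument of `Ξ` in `F t₁ t₂` when `t₂` is not contracted. -/
def rawArg (t : Tm S.C) : Tm S.C := .lam (.app t.lift.lift (.app (.var 1) (.var 0)))

/-- The second argument of `Ξ` in `F t₁ t₂`. -/
def fArg : Tm S.C → Tm S.C
  | .lam b => .lam (b.bind S.fSub)
  | t => S.rawArg t

theorem Ft_eq (t1 t2 : Tm S.C) :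
    S.Ft t1 t2 = .lam (.app (.app S.XiT t1.lift) (S.fArg t2)) := by
  cases t2 with
  | lam b =>
    simp only [Ft, fArg]
    congr 4
  | _ => rfl

theorem lift_bind_fSub (t : Tm S.C) : t.lift.bind S.fSub = t.lift.lift := by
  simp only [Tm.lift, Tm.bind_rename_left, Tm.rename_rename]
  rw [Tm.rename_eq_bind]
  rfl

theorem rawArg_bind (t : Tm S.C) (σ : Nat → Tm S.C) :
    (S.rawArg t).bind (Tm.upSub σ) = S.rawArg (t.bind σ) := by
  simp only [rawArg, Tm.bind_lam, Tm.bind, Tm.lift_bind_upSub]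
  rfl

theorem fArg_expand (t : Tm S.C) : S.fArg (.lam (.app t.lift (.var 0))) = S.rawArg t := by
  simp only [fArg, Tm.bind, lift_bind_fSub]
  rfl

theorem fArg_bind {t : Tm S.C} (ht : ∀ n, t ≠ .var n) (σ : Nat → Tm S.C) :
    (S.fArg t).bind (Tm.upSub σ) = S.fArg (t.bind σ) := by
  cases t with
  | var n => exact (ht n rfl).elim
  | const c => exact S.rawArg_bind _ σ
  | app a b => exact S.rawArg_bind _ σ
  | lam b =>
    rw [Tm.bind_lam]
    simp only [fArg, Tm.bind_lam, Tm.bind_bind]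
    congr 2
    funext n
    cases n with
    | zero => rfl
    | succ m =>
      simp only [Tm.upSub, lift_bind_fSub]
      rfl

theorem Ft_bind (t1 : Tm S.C) {t2 : Tm S.C} (ht : ∀ n, t2 ≠ .var n) (σ : Nat → Tm S.C) :
    (S.Ft t1 t2).bind σ = S.Ft (t1.bind σ) (t2.bind σ) := by
  rw [Ft_eq, Ft_eq, ← S.fArg_bind ht, Tm.bind_lam, ← Tm.lift_bind_upSub]
  rfl

theorem Ft_var_bind (t1 : Tm S.C) (n : Nat) (σ : Nat → Tm S.C) :
    (S.Ft t1 (.var n)).bind σ = S.Ft (t1.bind σ) (.lam (.app (σ n).lift (.var 0))) := by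
  rw [Ft_eq, Ft_eq, fArg_expand, Tm.bind_lam, ← Tm.lift_bind_upSub]
  have h := S.rawArg_bind (.var n) σ
  simp only [Tm.bind] at h ⊢
  rw [← h]
  rfl

theorem Ft_Kt (t1 q : Tm S.C) :
    S.Ft t1 (S.Kt q) = S.Kt (.app (.app S.XiT t1) (S.Kt q)) := by
  rw [Ft_eq]
  simp only [Kt, fArg, lift_bind_fSub]
  have h : (Tm.lam q.lift).lift = .lam q.lift.lift := by
    simp only [Tm.lift, Tm.rename_lam, Tm.rename_rename]
    rfl
  rw [← h]
  rfl

theorem Kt_eq_Ft {s t1 t2 : Tm S.C} (h : S.Kt s = S.Ft t1 t2) :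
    ∃ q, t2 = S.Kt q ∧ s = .app (.app S.XiT t1) (S.Kt q) := by
  have hq : ∃ q, t2 = S.Kt q := by
    have h' := h
    rw [Ft_eq, Kt, Tm.lam.injEq] at h'
    have h0 := Tm.not_freeIn_lift s
    rw [h'] at h0
    cases t2 with
    | lam b =>
      have hb : ¬ Tm.FreeIn 0 b := fun hb =>
        h0 (.inr (Tm.freeIn_bind.2 ⟨0, hb, .inl rfl⟩))
      obtain ⟨q, rfl⟩ := Tm.exists_lift_of_not_freeIn hb
      exact ⟨q, rfl⟩
    | _ => exact (h0 (.inr (.inr (.inl rfl)))).elim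
  obtain ⟨q, rfl⟩ := hq
  rw [Ft_Kt] at h
  exact ⟨q, rfl, S.Kt_injective h⟩

end CanSys

section Relations

variable {S : CanSys B D}

theorem Step.mono {α β : Ordinal.{0}} (hαβ : α ≤ β) {t u : Tm S.C} (h : Step S α t u) :
    Step S β t u := by
  induction t generalizing u with
  | var n => cases h
  | const c => cases h
  | app a b iha ihb =>
    cases h with
    | beta => exact .beta ..
    | crule hγ h1 hc hρ hs => exact .crule (hγ.trans_le hαβ) h1 hc hρ hs
    | appL _ h => exact .appL _ (iha h)
    | appR _ h => exact .appR _ (ihb h)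
  | lam a ih =>
    cases h with
    | eta => exact .eta ..
    | lam h => exact .lam (ih h)

theorem Steps.toReflTransGen {α : Ordinal.{0}} {t u : Tm S.C} :
    Steps S α t u → Relation.ReflTransGen (Step S α) t u
  | .refl _ _ => .refl
  | .tail h s => h.toReflTransGen.tail s

theorem steps_iff {α : Ordinal.{0}} {t u : Tm S.C} :
    Steps S α t u ↔ Relation.ReflTransGen (Step S α) t u := by
  refine ⟨Steps.toReflTransGen, fun h => ?_⟩
  induction h with
  | refl => exact .refl ..
  | tail _ s ih => exact .tail ih s

theorem Steps.single {α : Ordinal.{0}} {t u : Tm S.C} (h : Step S α t u) : Steps S α t u :=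
  .tail (.refl ..) h

theorem Steps.trans {α : Ordinal.{0}} {t u v : Tm S.C} (h : Steps S α t u) (h' : Steps S α u v) :
    Steps S α t v :=
  steps_iff.2 ((steps_iff.1 h).trans (steps_iff.1 h'))

theorem Steps.map {α β : Ordinal.{0}} (f : Tm S.C → Tm S.C)
    (hf : ∀ t u, Step S α t u → Steps S β (f t) (f u)) {t u : Tm S.C} (h : Steps S α t u) :
    Steps S β (f t) (f u) := by
  replace h := steps_iff.1 h
  induction h with
  | refl => exact .refl ..
  | tail _ s ih => exact ih.trans (hf _ _ s)

theorem Steps.mono {α β : Ordinal.{0}} (hαβ : α ≤ β) {t u : Tm S.C} (h : Steps S α t u) :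
    Steps S β t u :=
  h.map id fun _ _ h => .single (h.mono hαβ)

theorem LeadLt.mono {α β : Ordinal.{0}} (hαβ : α ≤ β) {t ρ : Tm S.C} (h : LeadLt S α t ρ) :
    LeadLt S β t ρ := by
  cases h with
  | mk hγ h => exact .mk (hγ.trans_le hαβ) h

theorem Sim.mono {α β : Ordinal.{0}} (hαβ : α ≤ β) {t : Tm S.C} {τ : ETy B} (h : Sim S α t τ) :
    Sim S β t τ := by
  cases h with
  | ofA => exact .ofA ..
  | ofH => exact .ofH ..
  | ofKom h => exact .ofKom (h.mono hαβ)
  | ofKeps h => exact .ofKeps (h.mono hαβ)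
  | ofF h1 h2 s1 s2 => exact .ofF (h1.trans_le hαβ) (h2.trans_le hαβ) s1 s2
  | ofFom h s => exact .ofFom (h.trans_le hαβ) s

theorem Sim.isTp {α : Ordinal.{0}} {t : Tm S.C} {τ : ETy B} (h : Sim S α t τ) : IsTp τ := by
  induction α using WellFoundedLT.induction generalizing t τ with
  | ind α ih =>
    cases h with
    | ofA => exact .inl (.base _)
    | ofH => exact .inl .o
    | ofKom h => exact .inr (.inl rfl)
    | ofKeps h => exact .inr (.inr rfl)
    | ofF h1 h2 s1 s2 => exact isTp_arrN (ih _ h1 s1) (ih _ h2 s2)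
    | ofFom h s => exact .inr (.inl rfl)

theorem Sim.ne_var {α : Ordinal.{0}} {t : Tm S.C} {τ : ETy B} (h : Sim S α t τ) (n : Nat) :
    t ≠ .var n := by
  cases h <;> exact fun h => Tm.noConfusion rfl (heq_of_eq h)

theorem Step.freeIn {α : Ordinal.{0}} {t u : Tm S.C} (h : Step S α t u) {n : Nat}
    (hu : Tm.FreeIn n u) : Tm.FreeIn n t := by
  induction t generalizing u n with
  | var n => cases h
  | const c => cases h
  | app a b iha ihb =>
    cases h with
    | beta _ t =>
      rw [Tm.subst0_eq, Tm.freeIn_bind] at hu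
      obtain ⟨_ | m, hm, hn⟩ := hu
      · exact .inr hn
      · cases hn
        exact .inl hm
    | crule hγ h1 hc hρ hs =>
      obtain ⟨h2, hF⟩ := S.F_mem hc hρ
      exact (S.not_freeIn h2 hF n hu).elim
    | appL _ h => exact hu.imp_left (iha h)
    | appR _ h => exact hu.imp_right (ihb h)
  | lam a ih =>
    cases h with
    | eta => exact .inl (Tm.freeIn_lift.2 hu)
    | lam h => exact ih h hu

/-- Closure of `≻_α` under substitution. -/
def SuccBind (S : CanSys B D) (α : Ordinal.{0}) : Prop :=
  ∀ (t ρ : Tm S.C) (σ : Nat → Tm S.C), Succ S α t ρ → Succ S α (t.bind σ) ρ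

theorem Step.bind_of {α : Ordinal.{0}} (hα : ∀ γ < α, SuccBind S γ) {t u : Tm S.C}
    (h : Step S α t u) (σ : Nat → Tm S.C) : Step S α (t.bind σ) (u.bind σ) := by
  induction t generalizing u σ with
  | var n => cases h
  | const c => cases h
  | app a b iha ihb =>
    cases h with
    | beta t =>
      rw [Tm.subst0_bind, Tm.bind, Tm.bind_lam]
      exact .beta ..
    | crule hγ h1 hc hρ hs =>
      obtain ⟨h2, hF⟩ := S.F_mem hc hρ
      rw [Tm.bind, S.bind_eq_self h2 hF, S.bind_eq_self (by simp) hc]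
      exact .crule hγ h1 hc hρ (hα _ hγ _ _ σ hs)
    | appL _ h => exact .appL _ (iha h σ)
    | appR _ h => exact .appR _ (ihb h σ)
  | lam a ih =>
    rw [Tm.bind_lam]
    cases h with
    | eta =>
      rw [Tm.bind, Tm.lift_bind_upSub]
      exact .eta ..
    | lam h =>
      rw [Tm.bind_lam]
      exact .lam (ih h _)

theorem LeadLt.bind_of {α : Ordinal.{0}} (hα : ∀ γ < α, SuccBind S γ) {t ρ : Tm S.C}
    (h : LeadLt S α t ρ) (σ : Nat → Tm S.C) : LeadLt S α (t.bind σ) ρ := by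
  cases h with
  | mk hγ h =>
    cases h with
    | mk hs hr =>
      exact .mk hγ (.mk (hs.map (·.bind σ) fun _ _ h =>
        .single (h.bind_of (fun δ hδ => hα δ (hδ.trans hγ)) σ)) (hα _ hγ _ _ σ hr))

theorem Sim.bind_of {α : Ordinal.{0}} (hα : ∀ γ < α, SuccBind S γ) {t : Tm S.C} {τ : ETy B}
    (h : Sim S α t τ) (σ : Nat → Tm S.C) : Sim S α (t.bind σ) τ := by
  induction α using WellFoundedLT.induction generalizing t τ with
  | ind α ih =>
    cases h with
    | ofA => exact .ofA ..
    | ofH => exact .ofH ..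
    | ofKom h =>
      rw [S.Kt_bind]
      exact .ofKom (h.bind_of hα σ)
    | ofKeps h =>
      rw [S.Kt_bind]
      exact .ofKeps (h.bind_of hα σ)
    | ofF h1 h2 s1 s2 =>
      rw [S.Ft_bind _ s2.ne_var]
      exact .ofF h1 h2 (ih _ h1 (fun δ hδ => hα δ (hδ.trans h1)) s1)
        (ih _ h2 (fun δ hδ => hα δ (hδ.trans h2)) s2)
    | @ofFom _ _ h1 t1 t2 s1 =>
      have s1' := ih _ h1 (fun δ hδ => hα δ (hδ.trans h1)) s1
      by_cases hv : ∃ n, t2 = .var n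
      · obtain ⟨n, rfl⟩ := hv
        rw [S.Ft_var_bind]
        exact .ofFom h1 s1'
      · rw [S.Ft_bind _ (not_exists.1 hv)]
        exact .ofFom h1 s1'

/-- Every application of an instance of `t` to an element of `T_τ` is an instance of such an
application of `t`. -/
theorem exists_app_bind (t : Tm S.C) (σ : Nat → Tm S.C) {τ : ETy B} {s : Tm S.C}
    (hs : s ∈ S.TT τ) :
    ∃ s' ∈ S.TT τ, ∃ σ', (τ ≠ .omega → s' = s) ∧ (Tm.app t s').bind σ' = .app (t.bind σ) s := by
  by_cases hτ : τ = .omega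
  · subst hτ
    obtain ⟨N, hN⟩ := t.exists_freeIn_bound
    refine ⟨.var N, by simp [S.TT_omega], Function.update σ N s, fun h => (h rfl).elim, ?_⟩
    simp only [Tm.bind, Function.update_self, Tm.app.injEq, and_true]
    refine Tm.bind_congr fun n hn => ?_
    rw [Function.update_of_ne (hN n hn).ne]
  · exact ⟨s, hs, σ, fun _ => rfl, by rw [Tm.bind, S.bind_eq_self hτ hs]⟩

theorem succBind (α : Ordinal.{0}) : SuccBind S α := by
  induction α using WellFoundedLT.induction with
  | ind α ih =>
    intro t ρ σ h
    cases h with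
    | refl hτ hρ =>
      rw [S.bind_eq_self hτ hρ]
      exact .refl hτ hρ _
    | @fn τ1 τ2 _ hρ _ _ h =>
      refine .fn hρ fun s hs => ?_
      obtain ⟨s', hs', σ', he, hb⟩ := exists_app_bind t σ hs
      have hF : S.F τ1 τ2 ρ s' = S.F τ1 τ2 ρ s := by
        by_cases hτ : τ1 = .omega
        · subst hτ
          have h2 := (S.isT1_of_mem (by simp) hρ).cod
          rw [S.TT_omega_arr τ2 h2] at hρ
          obtain ⟨ρ', hρ', rfl⟩ := hρ
          rw [S.F_omega _ _ hρ', S.F_omega _ _ hρ']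
        · rw [he hτ]
      rw [← hb, ← hF]
      exact (h s' hs').bind_of ih σ'
    | topLA => exact .topLA ..
    | topLH => exact .topLH ..
    | @topA b c hc =>
      rw [Tm.bind, S.bind_eq_self (by simp) hc]
      exact .topA hc _
    | @topH c hc =>
      have hc' : c ∈ S.TT .o := by simpa [S.TT_o] using hc
      rw [S.Ht_bind, S.bind_eq_self (by simp) hc']
      exact .topH hc _
    | xiTop h0 h1 h2 =>
      refine .xiTop h0 (h1.bind_of ih σ) fun s hs => ?_
      obtain ⟨s', hs', σ', -, hb⟩ := exists_app_bind _ σ hs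
      rw [← hb]
      exact (h2 s' hs').bind_of ih σ'
    | xiHTop h0 h1 h2 =>
      rw [S.Ht_bind]
      refine .xiHTop h0 (h1.bind_of ih σ) fun s hs => ?_
      obtain ⟨s', hs', σ', -, hb⟩ := exists_app_bind _ σ hs
      rw [← hb, ← S.Ht_bind]
      exact (h2 s' hs').bind_of ih σ'
    | @flTopEps _ _ t1 t2 h1 =>
      have h1' := h1.bind_of ih σ
      rw [Tm.bind]
      by_cases hv : ∃ n, t2 = .var n
      · obtain ⟨n, rfl⟩ := hv
        rw [S.Ft_var_bind]
        exact .flTopEps ‹_› h1'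
      · rw [S.Ft_bind _ (not_exists.1 hv)]
        exact .flTopEps ‹_› h1'
    | @flTop _ _ t1 t2 τ hτ h1 h2 =>
      have h1' := h1.bind_of ih σ
      have h2' := h2.bind_of ih σ
      rw [Tm.bind]
      by_cases hv : ∃ n, t2 = .var n
      · obtain ⟨n, rfl⟩ := hv
        rw [S.Ft_var_bind]
        refine .flTop ‹_› hτ h1' ?_
        cases h2' with
        | mk hγ h =>
          cases h with
          | mk hs hr =>
            exact .mk hγ (.mk ((Steps.single (.appR _ (.eta _ _))).trans hs) hr)
      · rw [S.Ft_bind _ (not_exists.1 hv)]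
        exact .flTop ‹_› hτ h1' h2'
    | hiTop h0 h =>
      rw [S.Ht_bind]
      exact .hiTop h0 (h.bind_of ih σ)
    | xiBot h0 hγ hH h1 h3 hb =>
      refine .xiBot h0 hγ ?_ (h1.bind_of ih σ) (S.bind_mem h3 σ) (hb.bind_of ih σ)
      have hH' := ih _ hγ _ _ σ hH
      rwa [S.Ht_bind] at hH'

theorem Step.bind {α : Ordinal.{0}} {t u : Tm S.C} (h : Step S α t u) (σ : Nat → Tm S.C) :
    Step S α (t.bind σ) (u.bind σ) :=
  h.bind_of (fun γ _ => succBind γ) σ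

theorem Step.rawArg {α : Ordinal.{0}} {t u : Tm S.C} (h : Step S α t u) :
    Step S α (S.rawArg t) (S.rawArg u) := by
  simp only [CanSys.rawArg, Tm.lift_eq_bind]
  exact .lam (.appL _ ((h.bind _).bind _))

theorem steps_rawArg_fArg (α : Ordinal.{0}) (t : Tm S.C) :
    Steps S α (S.rawArg t) (S.fArg t) := by
  cases t with
  | lam b =>
    have h : (Tm.lam b).lift.lift =
        .lam (b.rename (Tm.upRen (· + 1) ∘ Tm.upRen (· + 1))) := by
      simp only [Tm.lift, Tm.rename_lam, Tm.rename_rename]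
    rw [CanSys.rawArg, h]
    refine .single (.lam ?_)
    convert Step.beta α _ _ using 1
    rw [Tm.subst0_eq, Tm.bind_rename_left]
    congr 1
    funext n
    cases n <;> rfl
  | _ => exact .refl ..

theorem Step.fArg {α : Ordinal.{0}} {t u : Tm S.C} (h : Step S α t u) :
    Steps S α (S.fArg t) (S.fArg u) := by
  cases t with
  | var n => cases h
  | const c => cases h
  | app a b => exact (Steps.single h.rawArg).trans (steps_rawArg_fArg α u)
  | lam a =>
    cases h with
    | eta =>
      rw [S.fArg_expand]
      exact steps_rawArg_fArg α u
    | lam h => exact .single (.lam (h.bind _))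

theorem Steps.Ft {α : Ordinal.{0}} (t1 : Tm S.C) {t u : Tm S.C} (h : Steps S α t u) :
    Steps S α (S.Ft t1 t) (S.Ft t1 u) := by
  simp only [S.Ft_eq]
  exact (h.map S.fArg fun _ _ h => h.fArg).map (fun s => .lam (.app (.app S.XiT t1.lift) s))
    fun _ _ h => .single (.lam (.appR _ h))

theorem Steps.Kt_inv {α : Ordinal.{0}} {s u : Tm S.C} (h : Steps S α (S.Kt s) u) :
    ∃ s', u = S.Kt s' ∧ Steps S α s s' := by
  replace h := steps_iff.1 h
  induction h with
  | refl => exact ⟨s, rfl, .refl ..⟩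
  | tail _ hs ih =>
    obtain ⟨s', rfl, h'⟩ := ih
    suffices h : ∃ v, _ = S.Kt v ∧ Step S α s' v from
      let ⟨v, he, hv⟩ := h
      ⟨v, he, .tail h' hv⟩
    unfold CanSys.Kt at hs
    have h0 := Tm.not_freeIn_lift s'
    generalize ha : s'.lift = a at hs h0
    cases hs with
    | eta => exact (h0 (.inr rfl)).elim
    | lam hs =>
      obtain ⟨v, rfl⟩ := Tm.exists_lift_of_not_freeIn fun h => h0 (hs.freeIn h)
      have hv := hs.bind (Tm.instSub s')
      rw [← ha, Tm.lift_bind_instSub, Tm.lift_bind_instSub] at hv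
      exact ⟨v, rfl, hv⟩

theorem Steps.L_inv {α : Ordinal.{0}} {t u : Tm S.C} (h : Steps S α (.app S.LT t) u) :
    ∃ t', u = .app S.LT t' ∧ Steps S α t t' := by
  replace h := steps_iff.1 h
  induction h with
  | refl => exact ⟨t, rfl, .refl ..⟩
  | tail _ hs ih =>
    obtain ⟨t', rfl, h'⟩ := ih
    suffices h : ∃ v, _ = Tm.app S.LT v ∧ Step S α t' v from
      let ⟨v, he, hv⟩ := h
      ⟨v, he, .tail h' hv⟩
    have hL := S.LT_notMem
    generalize ha : S.LT = a at hs hL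
    cases hs with
    | beta => cases ha
    | crule hγ h1 hc => exact (hL _ (by simp) hc).elim
    | appL _ hs =>
      subst ha
      cases hs
    | appR _ hs => exact ⟨_, rfl, hs⟩

theorem Succ.L_inv {α : Ordinal.{0}} {t : Tm S.C} (h : Succ S α (.app S.LT t) S.top) :
    (∃ b, t = S.AT b) ∨ t = S.Hterm ∨
    (∃ s, t = S.Kt s ∧ (s = S.top ∨ s = S.bot ∨ LeadLt S α s S.top ∨
      ∃ t1 t2 τ, s = .app (.app S.XiT t1) t2 ∧ Sim S α t1 τ ∧
        ∀ t3 ∈ S.TT τ, LeadLt S α (S.Ht (.app t2 t3)) S.top)) ∨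
    ∃ t1 t2, t = S.Ft t1 t2 ∧ (Sim S α t1 .eps ∨
      ∃ τ, Sim S α t1 τ ∧ LeadLt S α (.app S.LT t2) S.top) := by
  generalize hx : Tm.app S.LT t = x at h
  generalize hr : S.top = r at h
  cases h with
  | refl hτ hρ =>
    subst hx
    exact (S.app_notMem hτ hρ).elim
  | fn hρ =>
    subst hr
    exact (S.top_notMem_arr _ _ hρ).elim
  | topLA _ b =>
    cases hx
    exact .inl ⟨b, rfl⟩
  | topLH =>
    cases hx
    exact .inr (.inl rfl)
  | topA => exact (S.hLA _ (by simpa [CanSys.LT, CanSys.AT] using (Tm.app.inj hx).1)).elim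
  | topH hc =>
    cases hx
    exact .inr (.inr (.inl ⟨_, rfl, hc.imp_right .inl⟩))
  | xiTop => cases hx
  | xiHTop _ h1 h2 =>
    cases hx
    exact .inr (.inr (.inl ⟨_, rfl, .inr (.inr (.inr ⟨_, _, _, rfl, h1, h2⟩))⟩))
  | flTopEps _ h1 =>
    cases hx
    exact .inr (.inr (.inr ⟨_, _, rfl, .inl h1⟩))
  | flTop _ _ h1 h2 =>
    cases hx
    exact .inr (.inr (.inr ⟨_, _, rfl, .inr ⟨_, h1, h2⟩⟩))
  | hiTop _ h =>
    cases hx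
    exact .inr (.inr (.inl ⟨_, rfl, .inr (.inr (.inl h))⟩))
  | xiBot => cases hx

/-- The truth value of `s` is determined at some stage. -/
def Decided (S : CanSys B D) (s : Tm S.C) : Prop :=
  (∃ β, Lead S β s S.top) ∨ ∃ β, Lead S β s S.bot

theorem Succ.mono {α β : Ordinal.{0}} (hαβ : α ≤ β) {t ρ : Tm S.C} (h : Succ S α t ρ) :
    Succ S β t ρ := by
  cases h with
  | refl hτ hρ => exact .refl hτ hρ _
  | fn hρ h => exact .fn hρ fun s hs => (h s hs).mono hαβ
  | topLA => exact .topLA ..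
  | topLH => exact .topLH ..
  | topA hc => exact .topA hc _
  | topH hc => exact .topH hc _
  | xiTop h0 h1 h2 => exact .xiTop (h0.trans_le hαβ) (h1.mono hαβ) fun s hs => (h2 s hs).mono hαβ
  | xiHTop h0 h1 h2 => exact .xiHTop (h0.trans_le hαβ) (h1.mono hαβ) fun s hs => (h2 s hs).mono hαβ
  | flTopEps h0 h1 => exact .flTopEps (h0.trans_le hαβ) (h1.mono hαβ)
  | flTop h0 hτ h1 h2 => exact .flTop (h0.trans_le hαβ) hτ (h1.mono hαβ) (h2.mono hαβ)
  | hiTop h0 h => exact .hiTop (h0.trans_le hαβ) (h.mono hαβ)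
  | xiBot h0 hγ hH h1 h3 hb =>
    exact .xiBot (h0.trans_le hαβ) (hγ.trans_le hαβ) hH (h1.mono hαβ) h3 (hb.mono hαβ)

theorem Lead.mono {α β : Ordinal.{0}} (hαβ : α ≤ β) {t ρ : Tm S.C} (h : Lead S α t ρ) :
    Lead S β t ρ := by
  cases h with
  | mk hs hr => exact .mk (hs.mono hαβ) (hr.mono hαβ)

theorem Decided.of_steps {α : Ordinal.{0}} {t u : Tm S.C} (h : Steps S α t u)
    (hu : Decided S u) : Decided S t := by
  have key : ∀ ρ, (∃ β, Lead S β u ρ) → ∃ β, Lead S β t ρ := by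
    rintro ρ ⟨β, hβ⟩
    have hβ' := hβ.mono (le_max_right α β)
    cases hβ' with
    | mk hs hr => exact ⟨max α β, .mk ((h.mono (le_max_left ..)).trans hs) hr⟩
  exact hu.imp (key _) (key _)

theorem Succ.lead {α : Ordinal.{0}} {t ρ : Tm S.C} (h : Succ S α t ρ) : Lead S α t ρ :=
  .mk (.refl ..) h

theorem Decided.Xi {α : Ordinal.{0}} {t1 t2 : Tm S.C} {τ : ETy B} (h1 : Sim S α t1 τ)
    (hH : Succ S α (S.Ht (.app (.app S.XiT t1) t2)) S.top)
    (h2 : ∀ t3 ∈ S.TT τ, Decided S (.app t2 t3)) :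
    Decided S (.app (.app S.XiT t1) t2) := by
  by_cases hall : ∀ t3 ∈ S.TT τ, ∃ β, Lead S β (.app t2 t3) S.top
  · choose! f hf using hall
    set β : Ordinal.{0} := ⨆ t3, f t3
    have hβ : ∀ t3, f t3 ≤ β := fun t3 => Ordinal.le_iSup f t3
    refine .inl ⟨max α (Order.succ β), Succ.lead (.xiTop ?_ (h1.mono (le_max_left ..)) ?_)⟩
    · exact lt_max_of_lt_right (Order.bot_lt_succ β)
    · exact fun t3 h3 => .mk (lt_max_of_lt_right (Order.lt_succ_of_le (hβ t3))) (hf t3 h3)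
  · push Not at hall
    obtain ⟨t3, h3, hn⟩ := hall
    rcases h2 t3 h3 with ⟨β, hβ⟩ | ⟨β, hβ⟩
    · exact (hn β hβ).elim
    · have hα : α < Order.succ (max α β) := Order.lt_succ_of_le (le_max_left ..)
      exact .inr ⟨Order.succ (max α β), Succ.lead (.xiBot (Order.bot_lt_succ _) hα hH
        (h1.mono hα.le) h3 (.mk (Order.lt_succ_of_le (le_max_right ..)) hβ))⟩

/-- If `H s ⇝_α ⊤` then `s ⇝ ⊤` or `s ⇝ ⊥`. -/
theorem decided_of_lead_Ht {α : Ordinal.{0}} {s : Tm S.C} (h : Lead S α (S.Ht s) S.top) :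
    Decided S s := by
  induction α using WellFoundedLT.induction generalizing s with
  | ind α ih =>
    have ih' : ∀ {s}, LeadLt S α (S.Ht s) S.top → Decided S s := fun h => by
      cases h with
      | mk hγ h => exact ih _ hγ h
    cases h with
    | mk hs hr =>
      obtain ⟨t', rfl, ht'⟩ := hs.L_inv
      obtain ⟨s', rfl, hs'⟩ := ht'.Kt_inv
      refine .of_steps hs' ?_
      rcases hr.L_inv with ⟨b, hb⟩ | hH | ⟨s'', he, hc⟩ | ⟨t1, t2, he, hc⟩
      · cases hb
      · have h0 := Tm.not_freeIn_lift s'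
        rw [Tm.lam.inj hH] at h0
        exact (h0 (.inr rfl)).elim
      · cases S.Kt_injective he
        rcases hc with rfl | rfl | hl | ⟨t1, t2, τ, rfl, h1, h2⟩
        · exact .inl ⟨0, Succ.lead (.refl (by simp) S.top_mem 0)⟩
        · exact .inr ⟨0, Succ.lead (.refl (by simp) S.bot_mem 0)⟩
        · cases hl with
          | mk _ hl => exact .inl ⟨_, hl⟩
        · exact .Xi h1 hr fun t3 h3 => ih' (h2 t3 h3)
      · obtain ⟨q, rfl, rfl⟩ := S.Kt_eq_Ft he
        rcases hc with h1 | ⟨τ, h1, h2⟩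
        · exact .Xi h1 hr fun t3 h3 => by simp [S.TT_eps] at h3
        · refine .Xi h1 hr fun t3 _ => .of_steps (α := α) (u := q) (.single ?_) (ih' h2)
          have hb := Step.beta (S := S) α q.lift t3
          rwa [Tm.subst0_eq, Tm.lift_bind_instSub] at hb

theorem Decided.sim_Kt {s : Tm S.C} (h : Decided S s) :
    ∃ τ : ETy B, IsTp τ ∧ SimS S (S.Kt s) τ := by
  rcases h with ⟨β, hβ⟩ | ⟨β, hβ⟩
  · exact ⟨.omega, .inr (.inl rfl), Order.succ β, .ofKom (.mk (Order.lt_succ β) hβ)⟩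
  · exact ⟨.eps, .inr (.inr rfl), Order.succ β, .ofKeps (.mk (Order.lt_succ β) hβ)⟩

end Relations

/-- **Lemma 4.18.**  If `L t ⇝_α ⊤` then `t ↠_{≤α} t' ∼ τ` for some term `t'` and
some type `τ ∈ T⁺`. -/
theorem l_sim_lemma {B : Type} [Finite B] {D : B → Type} (hD : ∀ b, Nonempty (D b))
    (S : CanSys B D) (α : Ordinal.{0}) (t : Tm S.C)
    (h : Lead S α (.app S.LT t) S.top) :
    ∃ (t' : Tm S.C) (τ : ETy B), IsTp τ ∧ Steps S α t t' ∧ SimS S t' τ := by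
  induction α using WellFoundedLT.induction generalizing t with
  | ind α ih =>
    cases h with
    | mk hs hr =>
      obtain ⟨t', rfl, ht'⟩ := hs.L_inv
      rcases hr.L_inv with ⟨b, rfl⟩ | rfl | ⟨s, rfl, -⟩ | ⟨t1, t2, rfl, h1 | ⟨τ, h1, h2⟩⟩
      · exact ⟨_, .base b, .inl (.base b), ht', 0, .ofA 0 b⟩
      · exact ⟨_, .o, .inl .o, ht', 0, .ofH 0⟩
      · obtain ⟨τ, hτ, h⟩ := (decided_of_lead_Ht (Succ.lead hr)).sim_Kt
        exact ⟨_, τ, hτ, ht', h⟩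
      · exact ⟨_, .omega, .inr (.inl rfl), ht', Order.succ α, .ofFom (Order.lt_succ α) h1⟩
      · cases h2 with
        | mk hγ h2 =>
          obtain ⟨t2', τ', hτ', hs2, β, h2'⟩ := ih _ hγ _ h2
          refine ⟨_, arrN τ τ', isTp_arrN h1.isTp hτ', ht'.trans ((hs2.mono hγ.le).Ft t1),
            Order.succ (max α β), ?_⟩
          exact .ofF (Order.lt_succ_of_le (le_max_left ..))
            (Order.lt_succ_of_le (le_max_right ..)) h1 h2'

end ILM
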